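/- Let H₁ and H₂ be real Hilbert spaces and let X = H₁ ⊕_∞ H₂ be their direct sum equipped with the maximum norm ‖(x₁, x₂)‖ = max{‖x₁‖, ‖x₂‖}. Then X satisfies the (r,s)-LKK* property for every r, s ∈ (0,1] with r² + s² ≤ 1. -/

import Mathlib

open Filter Topology

/-- A continuous functional on a Hilbert space attains its norm on the closed unit ball. -/
lemma exists_norm_le_one_apply_eq_norm {G : Type*} [NormedAddCommGroup G] [InnerProductSpace ℝ G]
    [CompleteSpace G] (φ : G →L[ℝ] ℝ) : ∃ x : G, ‖x‖ ≤ 1 ∧ φ x = ‖φ‖ := by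
  obtain ⟨a, rfl⟩ := (InnerProductSpace.toDual ℝ G).surjective φ
  refine ⟨‖a‖⁻¹ • a, ?_, ?_⟩
  · rw [norm_smul, norm_inv, norm_norm]
    exact inv_mul_le_one
  · rcases eq_or_ne a 0 with rfl | ha
    · simp
    · have : ‖a‖ ≠ 0 := norm_ne_zero_iff.2 ha
      simp only [map_smul, InnerProductSpace.toDual_apply_apply, real_inner_self_eq_norm_sq,
        LinearIsometryEquiv.norm_map, smul_eq_mul]
      field_simp

/-- The norm of a functional on a product with the maximum norm is the sum of the norms
of its restrictions to the factors. -/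
lemma norm_eq_norm_comp_inl_add_norm_comp_inr {E F : Type*} [NormedAddCommGroup E]
    [InnerProductSpace ℝ E] [CompleteSpace E] [NormedAddCommGroup F] [InnerProductSpace ℝ F]
    [CompleteSpace F] (f : (E × F) →L[ℝ] ℝ) :
    ‖f‖ = ‖f.comp (.inl ℝ E F)‖ + ‖f.comp (.inr ℝ E F)‖ := by
  have hsplit (x : E) (y : F) : f (x, y) = f.comp (.inl ℝ E F) x + f.comp (.inr ℝ E F) y := by
    simp [← map_add]
  apply le_antisymm
  · refine f.opNorm_le_bound (by positivity) fun z => ?_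
    obtain ⟨x, y⟩ := z
    rw [hsplit, add_mul]
    refine (norm_add_le _ _).trans (add_le_add ?_ ?_)
    · exact (ContinuousLinearMap.le_opNorm _ _).trans
        (mul_le_mul_of_nonneg_left (norm_fst_le (x, y)) (norm_nonneg _))
    · exact (ContinuousLinearMap.le_opNorm _ _).trans
        (mul_le_mul_of_nonneg_left (norm_snd_le (x, y)) (norm_nonneg _))
  · obtain ⟨x, hx, hfx⟩ := exists_norm_le_one_apply_eq_norm (f.comp (.inl ℝ E F))
    obtain ⟨y, hy, hfy⟩ := exists_norm_le_one_apply_eq_norm (f.comp (.inr ℝ E F))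
    rw [← hfx, ← hfy, ← hsplit]
    exact (le_abs_self _).trans (f.unit_le_opNorm (x, y) (max_le hx hy))

/-- The lower bound for weakly null perturbations of a functional on a Hilbert space, up to an
arbitrarily small error. -/
lemma eventually_mul_norm_add_mul_norm_le {G : Type*} [NormedAddCommGroup G]
    [InnerProductSpace ℝ G] [CompleteSpace G] {r s ε : ℝ} (hrs : r ^ 2 + s ^ 2 ≤ 1) (hε : 0 < ε)
    (φ : G →L[ℝ] ℝ) (ψ : ℕ → G →L[ℝ] ℝ) (hψ : ∀ x, Tendsto (fun n => ψ n x) atTop (𝓝 0)) :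
    ∀ᶠ n in atTop, r * ‖φ‖ + s * ‖ψ n‖ ≤ ‖φ + ψ n‖ + ε := by
  obtain ⟨a, rfl⟩ := (InnerProductSpace.toDual ℝ G).surjective φ
  have hδ : -(ε ^ 2 / 2) < 0 := by nlinarith
  filter_upwards [(hψ a).eventually_const_lt hδ] with n hn
  obtain ⟨u, hu⟩ := (InnerProductSpace.toDual ℝ G).surjective (ψ n)
  rw [← hu] at hn ⊢
  rw [InnerProductSpace.toDual_apply_apply, real_inner_comm] at hn
  rw [← map_add]
  simp only [LinearIsometryEquiv.norm_map]
  have hsq := norm_add_sq_real a u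
  refine (abs_le_of_sq_le_sq' ?_ (by positivity)).2
  have hcs : (r * ‖a‖ + s * ‖u‖) ^ 2 ≤ ‖a‖ ^ 2 + ‖u‖ ^ 2 := by
    nlinarith [sq_nonneg (r * ‖u‖ - s * ‖a‖), sq_nonneg ‖a‖, sq_nonneg ‖u‖,
      mul_le_mul_of_nonneg_right hrs (add_nonneg (sq_nonneg ‖a‖) (sq_nonneg ‖u‖))]
  nlinarith [mul_nonneg (norm_nonneg (a + u)) hε.le]

/-- For real Hilbert spaces `H₁, H₂`, the space `X = H₁ ⊕_∞ H₂` (the product carries the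
maximum norm) satisfies the `(r,s)`-LKK* property for all `r, s ∈ (0,1]` with
`r² + s² ≤ 1`. -/
theorem stmt_17 {H₁ H₂ : Type*} [NormedAddCommGroup H₁] [InnerProductSpace ℝ H₁]
    [CompleteSpace H₁] [NormedAddCommGroup H₂] [InnerProductSpace ℝ H₂] [CompleteSpace H₂]
    (r s : ℝ) (hr : r ∈ Set.Ioc (0 : ℝ) 1) (hs : s ∈ Set.Ioc (0 : ℝ) 1)
    (hrs : r ^ 2 + s ^ 2 ≤ 1) :
    -- X = H₁ ⊕_∞ H₂ satisfies the (r,s)-LKK* property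
    ∀ (f : (H₁ × H₂) →L[ℝ] ℝ) (g : ℕ → (H₁ × H₂) →L[ℝ] ℝ),
      (∀ x : H₁ × H₂, Tendsto (fun n => g n x) atTop (𝓝 0)) →
      r * ‖f‖ + s * limsup (fun n => ‖g n‖) atTop ≤ limsup (fun n => ‖f + g n‖) atTop := by
  intro f g hg
  obtain ⟨hs0, -⟩ := hs
  have bound : ∃ C, ∀ n, ‖g n‖ ≤ C := by
    refine banach_steinhaus fun x => ?_
    obtain ⟨C, hC⟩ := (hg x).norm.bddAbove_range
    exact ⟨C, fun n => hC ⟨n, rfl⟩⟩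
  obtain ⟨C, hC⟩ := bound
  have hbdd : IsBoundedUnder (· ≤ ·) atTop fun n => ‖f + g n‖ :=
    isBoundedUnder_of
      ⟨‖f‖ + C, fun n => (norm_add_le f (g n)).trans (add_le_add_right (hC n) ‖f‖)⟩
  have hcobdd : IsCoboundedUnder (· ≤ ·) atTop fun n => ‖g n‖ :=
    IsBoundedUnder.isCoboundedUnder_le (isBoundedUnder_of ⟨0, fun n => norm_nonneg (g n)⟩)
  refine le_of_forall_pos_le_add fun ε hε => ?_
  have hε3 : 0 < ε / 3 := by positivity
  have h₁ := eventually_mul_norm_add_mul_norm_le hrs hε3 (f.comp (.inl ℝ H₁ H₂))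
    (fun n => (g n).comp (.inl ℝ H₁ H₂)) fun x => hg (x, 0)
  have h₂ := eventually_mul_norm_add_mul_norm_le hrs hε3 (f.comp (.inr ℝ H₁ H₂))
    (fun n => (g n).comp (.inr ℝ H₁ H₂)) fun y => hg (0, y)
  have h₃ := eventually_lt_of_limsup_lt
    (lt_add_of_pos_right (limsup (fun n => ‖f + g n‖) atTop) hε3) hbdd
  have key : limsup (fun n => ‖g n‖) atTop ≤
      (limsup (fun n => ‖f + g n‖) atTop + ε - r * ‖f‖) / s := by
    refine limsup_le_of_le hcobdd ?_
    filter_upwards [h₁, h₂, h₃] with n hn₁ hn₂ hn₃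
    rw [le_div_iff₀ hs0]
    rw [norm_eq_norm_comp_inl_add_norm_comp_inr (f + g n), ContinuousLinearMap.add_comp,
      ContinuousLinearMap.add_comp] at hn₃
    rw [norm_eq_norm_comp_inl_add_norm_comp_inr f, norm_eq_norm_comp_inl_add_norm_comp_inr (g n)]
    linarith
  rw [le_div_iff₀ hs0] at key
  linarith
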